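/- arXiv:1805.01973 — 2 statements merged into one kernel-verified Lean document; each statement's English description precedes it below -/
import Mathlib

section
/- Suppose (X,T) satisfies the global specification property with gap constants M(ε). Then for every ε>0, setting M̃(ε) := M(ε/3), the following holds: for all n₁, n₂ ∈ ℕ, all M₁, M₂ ≥ M̃(ε) and all points x₁, x₂ ∈ X there exists a periodic point p ∈ P_{n₁+M₁+n₂+M₂} such that p ∈ B_ε^{n₁}(x₁) and T^{n₁+M₁} p ∈ B_ε^{n₂}(x₂). -/
open Filter Topology MeasureTheory

section Defs

variable {X : Type*}

/-- Periodic points of period `n`: `P_n = {x : T^n x = x}`. -/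
def per (T : X → X) (n : ℕ) : Set X := {x | T^[n] x = x}

/-- The set `P` of all periodic points. -/
def perP (T : X → X) : Set X := ⋃ n : ℕ, per T (n + 1)

/-- The Bowen ball `B_ε^n(x) = {y : d_n(x,y) < ε}`. -/
def bowen [PseudoMetricSpace X] (T : X → X) (n : ℕ) (ε : ℝ) (x : X) : Set X :=
  {y | ∀ k < n, dist (T^[k] x) (T^[k] y) < ε}

/-- The global specification property, with gap constants `M ε`. -/
def GlobalSpec [PseudoMetricSpace X] (T : X → X) (M : ℝ → ℕ) : Prop :=
  ∀ ε > (0 : ℝ), ∀ Mg, M ε ≤ Mg → ∀ k n : ℕ, ∀ x : Fin k → X,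
    ∃ p ∈ per T (k * (n + Mg)), ∀ i : Fin k, T^[i.val * (n + Mg)] p ∈ bowen T n ε (x i)

/-- The Birkhoff sum `S_m^n h (x) = ∑_{i=m}^{m+n-1} h (T^i x)`. -/
noncomputable def birk (T : X → X) (h : X → ℝ) (m n : ℕ) (x : X) : ℝ :=
  ∑ i ∈ Finset.range n, h (T^[m + i] x)

/-- The oscillation `ω_m^n(h, ε, x)` of `h` (as a function on the periodic points `P`). -/
noncomputable def osc [PseudoMetricSpace X] (T : X → X) (h : X → ℝ) (m n : ℕ) (ε : ℝ)
    (x : X) : ℝ :=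
  sSup {r | ∃ y ∈ bowen T n ε (T^[m] x) ∩ perP T, r = |birk T h m n x - birk T h 0 n y|}

/-- An `ε`-independent set `P ⊆ P_{k(n+M)}`. -/
def IsEpsIndep [PseudoMetricSpace X] (T : X → X) (ε : ℝ) (k n M : ℕ) (P : Finset X) : Prop :=
  ↑P ⊆ per T (k * (n + M)) ∧
  ∃ E : Finset X, ↑E ⊆ per T (n + M) ∧
    per T (k * (n + M)) ⊆ ⋃ x ∈ E, bowen T n (3 * ε) x ∧
    ∃ Φ : (Fin k → E) → P, Function.Bijective Φ ∧
      ∀ (x : Fin k → E) (i : Fin k), T^[i.val * (n + M)] (Φ x : X) ∈ bowen T n ε (x i : X)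

end Defs

section Prob

variable {α : Type*}

/-- Expectation with respect to the uniform measure on a finite set. -/
noncomputable def fexp (Z : Finset α) (h : α → ℝ) : ℝ := (∑ z ∈ Z, h z) / Z.card

/-- Variance with respect to the uniform measure on a finite set. -/
noncomputable def fvar (Z : Finset α) (h : α → ℝ) : ℝ := fexp Z fun z => (h z - fexp Z h) ^ 2

open Classical in
/-- The uniform probability of `W` for the uniform measure on the finite set `Z`. -/
noncomputable def fprob (Z : Finset α) (W : Set α) : ℝ :=
  ((Z.filter fun z => z ∈ W).card : ℝ) / Z.card

open Classical in
/-- The Lindeberg function `L_Z(h, η)`. -/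
noncomputable def flind (Z : Finset α) (h : α → ℝ) (η : ℝ) : ℝ :=
  fexp Z fun z => if η < |h z - fexp Z h| then (h z - fexp Z h) ^ 2 else 0

end Prob

/-- The distribution function of the standard normal distribution. -/
noncomputable def stdNormalCDF (t : ℝ) : ℝ :=
  (Real.sqrt (2 * Real.pi))⁻¹ * ∫ u in Set.Iic t, Real.exp (-u ^ 2 / 2)

/-- Bowen balls satisfy the triangle inequality. -/
theorem bowen_trans {X : Type*} [PseudoMetricSpace X] {T : X → X} {n : ℕ} {δ ε : ℝ} {x y z : X}
    (hxy : y ∈ bowen T n δ x) (hyz : z ∈ bowen T n ε y) : z ∈ bowen T n (δ + ε) x :=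
  fun k hk ↦ (dist_triangle _ _ _).trans_lt (add_lt_add (hxy k hk) (hyz k hk))

/-- A shadowing of `x` for times `0, …, m - 1` restricts to any window `a, …, a + n - 1`. -/
theorem bowen_iterate {X : Type*} [PseudoMetricSpace X] {T : X → X} {m n a : ℕ} {ε : ℝ} {x y : X}
    (h : y ∈ bowen T m ε x) (han : n + a ≤ m) : T^[a] y ∈ bowen T n ε (T^[a] x) := by
  intro k hk
  rw [← Function.iterate_add_apply, ← Function.iterate_add_apply]
  exact h (k + a) (by omega)

/-- Global specification with a single orbit piece: the closing property. -/
theorem GlobalSpec.exists_per_mem_bowen {X : Type*} [PseudoMetricSpace X] {T : X → X} {M : ℝ → ℕ}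
    (hspec : GlobalSpec T M) {ε : ℝ} (hε : 0 < ε) {Mg : ℕ} (hM : M ε ≤ Mg) (n : ℕ) (x : X) :
    ∃ p ∈ per T (n + Mg), p ∈ bowen T n ε x := by
  obtain ⟨p, hp, h⟩ := hspec ε hε Mg hM 1 n fun _ ↦ x
  exact ⟨p, by simpa using hp, by simpa using h 0⟩

/-- Two orbit pieces of different lengths can be shadowed by one (not necessarily periodic) point.
The first piece is replaced by a periodic one, so that it can be extended backwards. -/
theorem GlobalSpec.exists_mem_bowen_of_two {X : Type*} [PseudoMetricSpace X] {T : X → X}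
    {M : ℝ → ℕ} (hspec : GlobalSpec T M) {ε : ℝ} (hε : 0 < ε) {Mg : ℕ} (hM : M ε ≤ Mg)
    (n₁ n₂ : ℕ) (x₁ x₂ : X) :
    ∃ z ∈ bowen T n₁ (ε + ε) x₁, T^[n₁ + Mg] z ∈ bowen T n₂ ε x₂ := by
  obtain ⟨n, hn₁, hn₂⟩ : ∃ n, n₁ ≤ n ∧ n₂ ≤ n := ⟨max n₁ n₂, le_max_left _ _, le_max_right _ _⟩
  obtain ⟨q, hq, hqx⟩ := hspec.exists_per_mem_bowen hε hM n x₁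
  obtain ⟨p, -, hp⟩ := hspec ε hε Mg hM 2 n ![T^[n₁ + Mg] q, x₂]
  have hp₁ : p ∈ bowen T n ε (T^[n₁ + Mg] q) := by simpa using hp 0
  have hp₂ : T^[n + Mg] p ∈ bowen T n ε x₂ := by simpa using hp 1
  have hback : T^[n - n₁] (T^[n₁ + Mg] q) = q := by
    rw [← Function.iterate_add_apply, show n - n₁ + (n₁ + Mg) = n + Mg by omega]
    exact hq
  have hz := bowen_iterate (n := n₁) (a := n - n₁) hp₁ (by omega)
  rw [hback] at hz
  refine ⟨T^[n - n₁] p, bowen_trans (fun k hk ↦ hqx k (hk.trans_le hn₁)) hz, ?_⟩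
  rw [← Function.iterate_add_apply, show n₁ + Mg + (n - n₁) = n + Mg by omega]
  exact fun k hk ↦ hp₂ k (hk.trans_le hn₂)

/-- Under global specification, two orbit pieces of different lengths, separated by gaps
`M₁, M₂ ≥ M̃(ε) = M(ε/3)`, can be shadowed by a single periodic point. -/
theorem stmt0 {X : Type*} [MetricSpace X] [CompactSpace X] (T : X → X)
    (hT : Continuous T) (hfin : ∀ n : ℕ, (per T (n + 1)).Finite)
    (M : ℝ → ℕ) (hspec : GlobalSpec T M)
    (ε : ℝ) (hε : 0 < ε) (n₁ n₂ M₁ M₂ : ℕ)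
    (hM₁ : M (ε / 3) ≤ M₁) (hM₂ : M (ε / 3) ≤ M₂) (x₁ x₂ : X) :
    ∃ p ∈ per T (n₁ + M₁ + n₂ + M₂),
      p ∈ bowen T n₁ ε x₁ ∧ T^[n₁ + M₁] p ∈ bowen T n₂ ε x₂ := by
  have hε3 : 0 < ε / 3 := by positivity
  obtain ⟨z, hz₁, hz₂⟩ := hspec.exists_mem_bowen_of_two hε3 hM₁ n₁ n₂ x₁ x₂
  obtain ⟨p, hp, hpz⟩ := hspec.exists_per_mem_bowen hε3 hM₂ (n₁ + M₁ + n₂) z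
  refine ⟨p, hp, fun k hk ↦ ?_, fun k hk ↦ ?_⟩
  · have h := bowen_trans hz₁ (fun k hk ↦ hpz k (by omega)) k hk
    linarith
  · have h := bowen_trans hz₂ (bowen_iterate hpz (by omega)) k hk
    linarith
end

section
/- Let N ≥ 3 and 0 < r < 1. For each n ∈ ℕ choose two distinct words p(n) ≠ q(n) in {1,…,N−1}^n, and let Σ ⊂ {1,…,N}^ℤ be the subshift consisting of all bi-infinite sequences that contain no block of the form p(n)Nq(n)N for any n ∈ ℕ, equipped with the shift map σ and the metric d(x,y) := r^k, where k = min{ |l| : x_l ≠ y_l or x_{−l} ≠ y_{−l} }. Then (Σ,σ) does not have the local specification property. -/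
open Filter Topology

/-- The (two-sided) shift map on `ℤ → Fin N`. -/
def shiftZ {N : ℕ} (x : ℤ → Fin N) : ℤ → Fin N := fun i => x (i + 1)

/-- The metric `d(x,y) = r^k` with `k = min{|l| : x_l ≠ y_l or x_{-l} ≠ y_{-l}}` on the
two-sided full shift. -/
noncomputable def subDist {N : ℕ} (r : ℝ) (x y : ℤ → Fin N) : ℝ :=
  open Classical in
  if x = y then 0
  else r ^ sInf {k : ℕ | x (k : ℤ) ≠ y (k : ℤ) ∨ x (-(k : ℤ)) ≠ y (-(k : ℤ))}

/-- A block of the excluded form `p(m) N q(m) N` occurs in `x`; here `p m` and `q m` are the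
chosen words of length `m + 1` and `top` is the letter `N`. -/
def badOccurs {N : ℕ} (top : Fin N) (p q : (m : ℕ) → Fin (m + 1) → Fin N)
    (x : ℤ → Fin N) : Prop :=
  ∃ (m : ℕ) (j : ℤ),
    (∀ i : Fin (m + 1), x (j + (i.val : ℤ)) = p m i) ∧
    x (j + ((m : ℤ) + 1)) = top ∧
    (∀ i : Fin (m + 1), x (j + ((m : ℤ) + 2) + (i.val : ℤ)) = q m i) ∧
    x (j + (2 * (m : ℤ) + 3)) = top

/-- The subshift `Σ` obtained from the full shift on `{1,…,N}^ℤ` by excluding all blocks of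
the form `p(m) N q(m) N`. -/
def subSigma {N : ℕ} (top : Fin N) (p q : (m : ℕ) → Fin (m + 1) → Fin N) :
    Set (ℤ → Fin N) :=
  {x | ¬ badOccurs top p q x}

/-- The local specification property for the system `(Sig, S)` with distance function `d`. -/
def HasLocalSpecOn {α : Type*} (Sig : Set α) (S : α → α) (d : α → α → ℝ) : Prop :=
  ∀ ε > (0 : ℝ), ∃ (δ : ℝ) (Nε : ℕ), 0 < δ ∧
    ∀ (k n : ℕ) (hk : 0 < k), Nε ≤ n → ∀ x : Fin k → α,
      (∀ i, x i ∈ Sig) →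
      (∀ i : Fin k, d (S^[n] (x i)) (x ⟨(i.val + 1) % k, Nat.mod_lt _ hk⟩) < δ) →
      ∃ p ∈ Sig, S^[k * n] p = p ∧
        ∀ i : Fin k, ∀ j < n, d (S^[j] (S^[i.val * n] p)) (S^[j] (x i)) < ε

theorem shiftZ_iterate {N : ℕ} (x : ℤ → Fin N) (n : ℕ) (i : ℤ) :
    shiftZ^[n] x i = x (i + n) := by
  induction n generalizing i with
  | zero => simp
  | succ n ih =>
    rw [Function.iterate_succ_apply']
    change shiftZ^[n] x (i + 1) = _
    rw [ih]
    congr 1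
    push_cast
    ring

theorem apply_zero_eq_of_subDist_lt_one {N : ℕ} {r : ℝ} {x y : ℤ → Fin N}
    (h : subDist r x y < 1) : x 0 = y 0 := by
  by_contra hne
  have hxy : x ≠ y := fun e => hne (congrFun e 0)
  have h0 : sInf {k : ℕ | x (k : ℤ) ≠ y (k : ℤ) ∨ x (-(k : ℤ)) ≠ y (-(k : ℤ))} = 0 :=
    Nat.sInf_eq_zero.2 (Or.inl (Or.inl (by simpa using hne)))
  rw [subDist, if_neg hxy, h0] at h
  simp at h

theorem subDist_le_pow {N : ℕ} {r : ℝ} (hr0 : 0 < r) (hr1 : r < 1) {x y : ℤ → Fin N} {L : ℕ}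
    (h : ∀ l : ℤ, |l| < L → x l = y l) : subDist r x y ≤ r ^ L := by
  by_cases hxy : x = y
  · rw [subDist, if_pos hxy]
    positivity
  rw [subDist, if_neg hxy]
  apply pow_le_pow_of_le_one hr0.le hr1.le
  apply le_csInf
  · obtain ⟨l, hl⟩ := Function.ne_iff.1 hxy
    refine ⟨l.natAbs, ?_⟩
    rcases Int.natAbs_eq l with e | e
    · exact Or.inl (e ▸ hl)
    · exact Or.inr (e ▸ hl)
  · intro k hk
    by_contra! hlt
    have h1 : |(k : ℤ)| < L := by simpa using hlt
    have h2 : |-(k : ℤ)| < L := by simpa using hlt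
    rcases hk with hk | hk
    · exact hk (h _ h1)
    · exact hk (h _ h2)

/-- The sequence `… u top v top w …` whose only two letters `top` stand at the positions `-1`
and `m + 1`, with the words `u`, `v`, `w` read off from position `0` in windows starting at
`-(m + 2)`, `0` and `m + 2`. -/
def threeWords {N : ℕ} (top : Fin N) (m : ℕ) (u v w : ℤ → Fin N) : ℤ → Fin N := fun l =>
  if l = -1 ∨ l = m + 1 then top
  else if l < -1 then u (l + (m + 2))
  else if l < m + 1 then v l
  else w (l - (m + 2))

section threeWords

variable {N : ℕ} {top : Fin N} {m : ℕ} {u v w : ℤ → Fin N}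

theorem threeWords_left {l : ℤ} (hl : l < -1) :
    threeWords top m u v w l = u (l + (m + 2)) := by
  rw [threeWords, if_neg (by omega), if_pos hl]

theorem threeWords_middle {l : ℤ} (h0 : 0 ≤ l) (hl : l < m + 1) :
    threeWords top m u v w l = v l := by
  rw [threeWords, if_neg (by omega), if_neg (by omega), if_pos hl]

theorem threeWords_right {l : ℤ} (hl : m + 1 < l) :
    threeWords top m u v w l = w (l - (m + 2)) := by
  rw [threeWords, if_neg (by omega), if_neg (by omega), if_neg (by omega)]

theorem threeWords_neg_one : threeWords top m u v w (-1) = top := by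
  simp [threeWords]

theorem threeWords_add_one : threeWords top m u v w (m + 1) = top := by
  simp [threeWords]

theorem eq_or_eq_of_threeWords_eq_top (hu : ∀ l, u l ≠ top) (hv : ∀ l, v l ≠ top)
    (hw : ∀ l, w l ≠ top) {l : ℤ} (h : threeWords top m u v w l = top) :
    l = -1 ∨ l = m + 1 := by
  by_contra hl
  rw [threeWords, if_neg hl] at h
  split_ifs at h
  exacts [hu _ h, hv _ h, hw _ h]

theorem threeWords_mem_subSigma {p q : (m : ℕ) → Fin (m + 1) → Fin N}
    (hu : ∀ l, u l ≠ top) (hv : ∀ l, v l ≠ top) (hw : ∀ l, w l ≠ top)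
    (h : ¬ ((∀ i : Fin (m + 1), u (i.val : ℤ) = p m i) ∧
      ∀ i : Fin (m + 1), v (i.val : ℤ) = q m i)) :
    threeWords top m u v w ∈ subSigma top p q := by
  rintro ⟨m', j, hpj, h1, hqj, h2⟩
  have h1 := eq_or_eq_of_threeWords_eq_top hu hv hw h1
  have h2 := eq_or_eq_of_threeWords_eq_top hu hv hw h2
  obtain rfl : m' = m := by omega
  obtain rfl : j = -(m' + 2) := by omega
  refine h ⟨fun i => ?_, fun i => ?_⟩
  · rw [← hpj i, threeWords_left (by omega)]
    congr 1
    ring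
  · rw [← hqj i, threeWords_middle (by omega) (by omega)]
    congr 1
    ring

/-- Shifting by one word length matches two such sequences in a window of radius `m`, even when
the first letter of the left word of the second one is altered. -/
theorem subDist_shiftZ_threeWords_le {r : ℝ} (hr0 : 0 < r) (hr1 : r < 1)
    {u' v' w' : ℤ → Fin N} (hvu : ∀ l, 0 < l → v l = u' l) (hwv : ∀ l, w l = v' l) :
    subDist r (shiftZ^[m + 2] (threeWords top m u v w)) (threeWords top m u' v' w')
      ≤ r ^ (m + 1) := by
  apply subDist_le_pow hr0 hr1
  intro l hl
  rw [abs_lt] at hl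
  push_cast at hl
  rw [shiftZ_iterate]
  push_cast
  rcases lt_trichotomy l (-1) with h | rfl | h
  · rw [threeWords_left h, threeWords_middle (by omega) (by omega), hvu _ (by omega)]
  · rw [threeWords_neg_one, show (-1 : ℤ) + (m + 2) = m + 1 by ring, threeWords_add_one]
  · rw [threeWords_right (by omega), threeWords_middle (by omega) (by omega), hwv]
    congr 1
    ring

end threeWords

/-- A finite word extended to `ℤ` by the letter `c`. -/
def extendWord {N m : ℕ} (c : Fin N) (s : Fin (m + 1) → Fin N) (l : ℤ) : Fin N :=
  if h : l.toNat < m + 1 then s ⟨l.toNat, h⟩ else c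

theorem extendWord_apply {N m : ℕ} (c : Fin N) (s : Fin (m + 1) → Fin N) (i : Fin (m + 1)) :
    extendWord c s (i.val : ℤ) = s i := by
  rw [extendWord, dif_pos (by omega)]
  simp

theorem extendWord_ne {N m : ℕ} {c top : Fin N} {s : Fin (m + 1) → Fin N} (hc : c ≠ top)
    (hs : ∀ i, s i ≠ top) (l : ℤ) : extendWord c s l ≠ top := by
  unfold extendWord
  split_ifs
  exacts [hs _, hc]

/-- Example 3: the subshift obtained by excluding the blocks `p(m) N q(m) N` does not have
the local specification property. -/
theorem stmt17 (N : ℕ) (hN : 3 ≤ N) (r : ℝ) (hr0 : 0 < r) (hr1 : r < 1)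
    (top : Fin N) (htop : (top : ℕ) = N - 1)
    (p q : (m : ℕ) → Fin (m + 1) → Fin N)
    (hp : ∀ m i, p m i ≠ top) (hq : ∀ m i, q m i ≠ top)
    (hpq : ∀ m, p m ≠ q m) :
    ¬ HasLocalSpecOn (subSigma top p q) shiftZ (subDist r) := by
  intro hspec
  obtain ⟨δ, M, hδ, hspec⟩ := hspec 1 one_pos
  obtain ⟨K, hK⟩ := exists_pow_lt_of_lt_one hδ hr1
  set m := K + M
  have hm : r ^ (m + 1) < δ := (pow_le_pow_of_le_one hr0.le hr1.le (by omega)).trans_lt hK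
  obtain ⟨c, hc, hcp⟩ : ∃ c : Fin N, c ≠ top ∧ c ≠ p m 0 := by
    have hcard : ({top, p m 0} : Finset (Fin N)).card < Fintype.card (Fin N) := by
      have := Finset.card_le_two (a := top) (b := p m 0)
      rw [Fintype.card_fin]
      omega
    obtain ⟨c, hc⟩ := Finset.exists_mem_notMem_of_card_lt_card (t := Finset.univ) hcard
    exact ⟨c, by simpa using hc⟩
  set P := extendWord c (p m)
  set Q := extendWord c (q m)
  have hPp : ∀ i : Fin (m + 1), P (i.val : ℤ) = p m i := extendWord_apply c (p m)
  have hQq : ∀ i : Fin (m + 1), Q (i.val : ℤ) = q m i := extendWord_apply c (q m)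
  have hP : ∀ l, P l ≠ top := extendWord_ne hc (hp m)
  have hQ : ∀ l, Q l ≠ top := extendWord_ne hc (hq m)
  have hP' : ∀ l, Function.update P 0 c l ≠ top := by
    intro l
    rw [Function.update_apply]
    split_ifs
    exacts [hc, hP l]
  set x := threeWords top m Q P Q with hx_def
  set y := threeWords top m (Function.update P 0 c) Q P with hy_def
  have hx : x ∈ subSigma top p q := by
    refine threeWords_mem_subSigma hQ hP hQ fun h => hpq m (funext fun i => ?_)
    rw [← h.2 i, hPp]
  have hy : y ∈ subSigma top p q := by
    refine threeWords_mem_subSigma hP' hQ hP fun h => hcp ?_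
    simpa using h.1 0
  have hxy : subDist r (shiftZ^[m + 2] x) y < δ := by
    refine (subDist_shiftZ_threeWords_le hr0 hr1 (fun l hl => ?_) fun _ => rfl).trans_lt hm
    rw [Function.update_of_ne hl.ne']
  have hyx : subDist r (shiftZ^[m + 2] y) x < δ :=
    (subDist_shiftZ_threeWords_le hr0 hr1 (fun _ _ => rfl) fun _ => rfl).trans_lt hm
  obtain ⟨z, hz, -, hzs⟩ := hspec 2 (m + 2) two_pos (by omega) ![x, y]
    (by simp [Fin.forall_fin_two, hx, hy])
    (by
      rw [Fin.forall_fin_two]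
      exact ⟨hxy, hyx⟩)
  have hzx : ∀ j < m + 2, z j = x j := by
    intro j hj
    have := apply_zero_eq_of_subDist_lt_one (hzs 0 j hj)
    simpa [shiftZ_iterate] using this
  have hzy : ∀ j < m + 2, z (m + 2 + j) = y j := by
    intro j hj
    have := apply_zero_eq_of_subDist_lt_one (hzs 1 j hj)
    rw [shiftZ_iterate, shiftZ_iterate, shiftZ_iterate] at this
    simpa [add_comm] using this
  refine hz ⟨m, 0, fun i => ?_, ?_, fun i => ?_, ?_⟩
  · rw [zero_add, hzx _ (by omega), hx_def, threeWords_middle (by omega) (by omega), hPp]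
  · have := hzx (m + 1) (by omega)
    push_cast at this
    rw [zero_add, this, hx_def, threeWords_add_one]
  · rw [zero_add, hzy _ (by omega), hy_def, threeWords_middle (by omega) (by omega), hQq]
  · have := hzy (m + 1) (by omega)
    push_cast at this
    rw [show (0 : ℤ) + (2 * m + 3) = m + 2 + (m + 1) by ring, this, hy_def, threeWords_add_one]
end
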